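/- The point [2 : -1 : -1 : 1 : 1 : 1] is a singular point of the projective surface X ⊂ ℙ⁵ defined by x+y+z = 0, xy+yz+zx = -(a²+b²+c²), xyz = 2abc, and its orbit under the group G generated by permutations of (x,y,z), permutations of (a,b,c), and sign changes of two of a,b,c, consists of exactly 12 points, which are precisely all singular points of X. -/

import Mathlib

/-! STATEMENT 19.  Points of `ℙ⁵` with coordinates `[x:y:z:a:b:c]` are represented by
nonzero vectors `p = ((x,y,z),(a,b,c)) : (Fin 3 → k) × (Fin 3 → k)` up to scaling. -/

/-- `p` satisfies the three defining equations of the surface `X ⊂ ℙ⁵`: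
`x+y+z = 0`, `xy+yz+zx+a²+b²+c² = 0`, `xyz-2abc = 0`. -/
def OnX {k : Type*} [Field k] (p : (Fin 3 → k) × (Fin 3 → k)) : Prop :=
  p.1 0 + p.1 1 + p.1 2 = 0 ∧
  p.1 0 * p.1 1 + p.1 1 * p.1 2 + p.1 2 * p.1 0 +
    p.2 0 ^ 2 + p.2 1 ^ 2 + p.2 2 ^ 2 = 0 ∧
  p.1 0 * p.1 1 * p.1 2 - 2 * p.2 0 * p.2 1 * p.2 2 = 0

/-- The Jacobian matrix of the three defining equations of `X` at `p`, with the six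
columns indexed by `Fin 3 ⊕ Fin 3` (the `x,y,z` and the `a,b,c` partial derivatives). -/
def jacX {k : Type*} [Field k] (p : (Fin 3 → k) × (Fin 3 → k)) :
    Matrix (Fin 3) (Fin 3 ⊕ Fin 3) k :=
  Matrix.of fun r =>
    Sum.elim
      ((![![1, 1, 1],
          ![p.1 1 + p.1 2, p.1 0 + p.1 2, p.1 0 + p.1 1],
          ![p.1 1 * p.1 2, p.1 0 * p.1 2, p.1 0 * p.1 1]]) r)
      ((![![0, 0, 0],
          ![2 * p.2 0, 2 * p.2 1, 2 * p.2 2],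
          ![-2 * p.2 1 * p.2 2, -2 * p.2 0 * p.2 2, -2 * p.2 0 * p.2 1]]) r)

/-- `p` represents a singular point of `X`: it is a nonzero vector lying on `X` at which
the Jacobian matrix of the defining equations has rank `< 3`. -/
def IsSingularPt {k : Type*} [Field k] (p : (Fin 3 → k) × (Fin 3 → k)) : Prop :=
  p ≠ 0 ∧ OnX p ∧ (jacX p).rank < 3

/-- The action of a group element of `G`: a permutation `σ` of the coordinates `x,y,z`,
a permutation `τ` of the coordinates `a,b,c`, and a sign change `ε` on `a,b,c`. -/
def act {k : Type*} [Field k] (σ τ : Equiv.Perm (Fin 3)) (ε : Fin 3 → k)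
    (p : (Fin 3 → k) × (Fin 3 → k)) : (Fin 3 → k) × (Fin 3 → k) :=
  (fun i => p.1 (σ i), fun i => ε i * p.2 (τ i))

/-- The representative vector of the point `[2:-1:-1:1:1:1]`. -/
def pt0 {k : Type*} [Field k] : (Fin 3 → k) × (Fin 3 → k) :=
  (![2, -1, -1], ![1, 1, 1])

/-- The orbit of `[2:-1:-1:1:1:1]` under the group `G ≅ (V₄ ⋊ S₃) × S₃` generated by
permutations of `(x,y,z)`, permutations of `(a,b,c)`, and sign changes of two of
`a,b,c` (i.e. sign vectors `ε ∈ {±1}³` with `ε₀ε₁ε₂ = 1`). -/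
def orbitPt0 (k : Type*) [Field k] : Set ((Fin 3 → k) × (Fin 3 → k)) :=
  {q | ∃ σ τ : Equiv.Perm (Fin 3), ∃ ε : Fin 3 → k,
    (∀ i, ε i = 1 ∨ ε i = -1) ∧ ε 0 * ε 1 * ε 2 = 1 ∧ q = act σ τ ε pt0}

/-- A matrix over a field with three rows has rank less than three exactly when its rows
satisfy a nontrivial linear relation. -/
theorem rank_lt_three_iff {k n : Type*} [Field k] [Fintype n] (M : Matrix (Fin 3) n k) :
    M.rank < 3 ↔ ∃ v : Fin 3 → k, v ≠ 0 ∧ ∀ j, v 0 * M 0 j + v 1 * M 1 j + v 2 * M 2 j = 0 := by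
  have key : M.rank < 3 ↔ ¬ LinearIndependent k M.row := by
    rw [linearIndependent_iff_card_eq_finrank_span, Set.finrank, ← M.rank_eq_finrank_span_row,
      Fintype.card_fin]
    have := M.rank_le_card_height
    rw [Fintype.card_fin] at this
    omega
  rw [key, Fintype.not_linearIndependent_iff]
  simp only [funext_iff, Fin.sum_univ_three, Function.ne_iff, Matrix.row, Pi.add_apply,
    Pi.smul_apply, Pi.zero_apply, smul_eq_mul]
  exact exists_congr fun v => and_comm

/-- Representatives of the nodes of `X`: the first index is the position of the coordinate `2`
among `x, y, z`, and the two units are the signs of `a` and `b`. -/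
def nodeX (k : Type*) [Field k] (d : Fin 3 × ℤˣ × ℤˣ) : (Fin 3 → k) × (Fin 3 → k) :=
  (fun j => if j = d.1 then 2 else -1,
    ![((d.2.1 : ℤ) : k), ((d.2.2 : ℤ) : k), ((d.2.1 : ℤ) : k) * ((d.2.2 : ℤ) : k)])

theorem cast_unit_sq {k : Type*} [Field k] (s : ℤˣ) : ((s : ℤ) : k) ^ 2 = 1 := by
  rcases Int.units_eq_one_or s with rfl | rfl <;> simp

theorem exists_cast_unit_mul {k : Type*} [Field k] {a c : k} (h : a ^ 2 = c ^ 2) :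
    ∃ s : ℤˣ, a = c * ((s : ℤ) : k) := by
  rcases sq_eq_sq_iff_eq_or_eq_neg.mp h with h | h
  · exact ⟨1, by simp [h]⟩
  · exact ⟨-1, by simp [h]⟩

theorem cast_unit_injective {k : Type*} [Field k] [CharZero k] :
    Function.Injective fun s : ℤˣ => ((s : ℤ) : k) :=
  Int.cast_injective.comp Units.val_injective

theorem mem_orbitPt0_iff {k : Type*} [Field k] (q : (Fin 3 → k) × (Fin 3 → k)) :
    q ∈ orbitPt0 k ↔ ∃ d, q = nodeX k d := by
  have pt0_fst (j : Fin 3) : (pt0 (k := k)).1 j = if j = 0 then 2 else -1 := by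
    fin_cases j <;> simp [pt0]
  have pt0_snd (j : Fin 3) : (pt0 (k := k)).2 j = 1 := by
    fin_cases j <;> simp [pt0]
  constructor
  · rintro ⟨σ, τ, ε, hε, hprod, rfl⟩
    have sq (i : Fin 3) : ε i ^ 2 = 1 ^ 2 := by rcases hε i with h | h <;> simp [h]
    obtain ⟨s, hs⟩ := exists_cast_unit_mul (sq 0)
    obtain ⟨t, ht⟩ := exists_cast_unit_mul (sq 1)
    rw [one_mul] at hs ht
    refine ⟨(σ.symm 0, s, t), Prod.ext ?_ ?_⟩
    · funext j
      simp [act, nodeX, pt0_fst, Equiv.eq_symm_apply]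
    · have h2 : ε 2 = ε 0 * ε 1 := by
        linear_combination ε 0 * ε 1 * hprod - ε 2 * ε 1 ^ 2 * sq 0 - ε 2 * sq 1
      funext j
      fin_cases j <;> simp [act, nodeX, pt0_snd, ← hs, ← ht, h2]
  · rintro ⟨⟨i, s, t⟩, rfl⟩
    refine ⟨Equiv.swap 0 i, 1, (nodeX k (i, s, t)).2, ?_, ?_, Prod.ext ?_ ?_⟩
    · intro j
      rcases Int.units_eq_one_or s with rfl | rfl <;>
        rcases Int.units_eq_one_or t with rfl | rfl <;> fin_cases j <;> simp [nodeX]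
    · simp only [nodeX, Matrix.cons_val]
      linear_combination ((t : ℤ) : k) ^ 2 * cast_unit_sq (k := k) s + cast_unit_sq (k := k) t
    · funext j
      simp [act, nodeX, pt0_fst, Equiv.swap_apply_eq_iff]
    · funext j
      simp [act, pt0_snd]

theorem nodeX_eq_of_smul {k : Type*} [Field k] [CharZero k] {d d' : Fin 3 × ℤˣ × ℤˣ} {c : k}
    (h : nodeX k d = c • nodeX k d') : d = d' := by
  obtain ⟨i, s, t⟩ := d
  obtain ⟨i', s', t'⟩ := d'
  have hx (j : Fin 3) : (if j = i then (2 : k) else -1) = c * if j = i' then 2 else -1 :=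
    congrFun (congrArg Prod.fst h) j
  have h2 : ((2 : k) = -1) ↔ False := by
    refine iff_false_intro fun h => ?_
    have : (3 : k) = 0 := by linear_combination h
    norm_num at this
  have hi : i = i' ∧ c = 1 := by
    have e0 := hx 0
    have e1 := hx 1
    have e2 := hx 2
    fin_cases i <;> fin_cases i' <;> simp at e0 e1 e2 ⊢ <;> grind
  obtain ⟨rfl, rfl⟩ := hi
  have ha := congrFun (congrArg Prod.snd h) 0
  have hb := congrFun (congrArg Prod.snd h) 1
  simp only [one_smul, nodeX, Matrix.cons_val] at ha hb
  rw [cast_unit_injective ha, cast_unit_injective hb]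

theorem isSingularPt_smul_nodeX {k : Type*} [Field k] [CharZero k] (d : Fin 3 × ℤˣ × ℤˣ)
    {c : k} (hc : c ≠ 0) : IsSingularPt (c • nodeX k d) := by
  obtain ⟨i, s, t⟩ := d
  have hs := cast_unit_sq (k := k) s
  have ht := cast_unit_sq (k := k) t
  refine ⟨fun h => ?_, ?_, (rank_lt_three_iff _).mpr ⟨![c ^ 2, c, 1], ?_, ?_⟩⟩
  · have := congrFun (congrArg Prod.snd h) 0
    simp [nodeX, hc] at this
  · refine ⟨?_, ?_, ?_⟩ <;> fin_cases i <;> simp [nodeX] <;> grind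
  · exact fun h => one_ne_zero (congrFun h 2)
  · rintro (j | j) <;> fin_cases j <;> fin_cases i <;> simp [nodeX, jacX] <;> grind

theorem exists_smul_nodeX_of_isSingularPt {k : Type*} [Field k] [CharZero k]
    {p : (Fin 3 → k) × (Fin 3 → k)} (hp : IsSingularPt p) :
    ∃ d, ∃ c : k, c ≠ 0 ∧ p = c • nodeX k d := by
  obtain ⟨hp0, ⟨h1, h2, h3⟩, hr⟩ := hp
  obtain ⟨v, hv, hj⟩ := (rank_lt_three_iff _).mp hr
  have ex := hj (Sum.inl 0)
  have ey := hj (Sum.inl 1)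
  have ez := hj (Sum.inl 2)
  have ea := hj (Sum.inr 0)
  have eb := hj (Sum.inr 1)
  have ec := hj (Sum.inr 2)
  have hv3 : ¬(v 0 = 0 ∧ v 1 = 0 ∧ v 2 = 0) := fun h => hv <| by
    funext j
    fin_cases j
    exacts [h.1, h.2.1, h.2.2]
  have hp6 : ¬((p.1 0 = 0 ∧ p.1 1 = 0 ∧ p.1 2 = 0) ∧ p.2 0 = 0 ∧ p.2 1 = 0 ∧ p.2 2 = 0) :=
    fun h => hp0 <| by
      ext j <;> fin_cases j
      exacts [h.1.1, h.1.2.1, h.1.2.2, h.2.1, h.2.2.1, h.2.2.2]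
  simp only [jacX, Matrix.of_apply, Sum.elim_inl, Sum.elim_inr, Matrix.cons_val]
    at ex ey ez ea eb ec
  have two : (2 : k) ≠ 0 := two_ne_zero
  have ea' : v 1 * p.2 0 = v 2 * (p.2 1 * p.2 2) :=
    mul_left_cancel₀ two (by linear_combination ea)
  have eb' : v 1 * p.2 1 = v 2 * (p.2 2 * p.2 0) :=
    mul_left_cancel₀ two (by linear_combination eb)
  have ec' : v 1 * p.2 2 = v 2 * (p.2 0 * p.2 1) :=
    mul_left_cancel₀ two (by linear_combination ec)
  have hn : v 2 ≠ 0 := by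
    intro hn
    have hm : v 1 ≠ 0 := by grind
    have hxy : p.1 0 = p.1 1 := mul_left_cancel₀ hm (by grind)
    have hxz : p.1 0 = p.1 2 := mul_left_cancel₀ hm (by grind)
    have hx : p.1 0 = 0 := by
      have : (3 : k) * p.1 0 = 0 := by linear_combination h1 + hxy + hxz
      simpa using this
    simp only [hn, zero_mul, mul_eq_zero, hm, false_or] at ea' eb' ec'
    exact hp6 ⟨⟨hx, hxy ▸ hx, hxz ▸ hx⟩, ea', eb', ec'⟩
  have exy : (p.1 0 - p.1 1) * (v 1 + v 2 * p.1 2) = 0 := by linear_combination ey - ex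
  have eyz : (p.1 1 - p.1 2) * (v 1 + v 2 * p.1 0) = 0 := by linear_combination ez - ey
  have ezx : (p.1 2 - p.1 0) * (v 1 + v 2 * p.1 1) = 0 := by linear_combination ex - ez
  obtain ⟨i, t, hX, hm⟩ : ∃ (i : Fin 3) (t : k),
      p.1 = (fun j => t * if j = i then 2 else -1) ∧ (t = 0 ∨ v 1 = v 2 * t) := by
    have of_eq {x y z : k} (h : x + y + z = 0) (hyz : y = z)
        (e : (x - y) * (v 1 + v 2 * z) = 0) :
        x = -z * 2 ∧ y = -z * -1 ∧ z = -z * -1 ∧ (-z = 0 ∨ v 1 = v 2 * -z) := by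
      refine ⟨by linear_combination h - hyz, by linear_combination hyz, by ring, ?_⟩
      rcases mul_eq_zero.mp e with e | e
      · left
        have : (3 : k) * -z = 0 := by linear_combination e - h + 2 * hyz
        simpa using this
      · exact Or.inr (by linear_combination e)
    have cases_eq : p.1 1 = p.1 2 ∨ p.1 2 = p.1 0 ∨ p.1 0 = p.1 1 := by
      rcases mul_eq_zero.mp eyz with h | h
      · exact Or.inl (sub_eq_zero.mp h)
      rcases mul_eq_zero.mp exy with h' | h'
      · exact Or.inr (Or.inr (sub_eq_zero.mp h'))
      · exact Or.inr (Or.inl (mul_left_cancel₀ hn (by linear_combination h' - h)))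
    rcases cases_eq with h | h | h
    · obtain ⟨hx, hy, hz, ht⟩ := of_eq h1 h exy
      refine ⟨0, -p.1 2, ?_, ht⟩
      funext j
      fin_cases j
      exacts [hx, hy, hz]
    · obtain ⟨hy, hz, hx, ht⟩ := of_eq (by linear_combination h1) h eyz
      refine ⟨1, -p.1 0, ?_, ht⟩
      funext j
      fin_cases j
      exacts [hx, hy, hz]
    · obtain ⟨hz, hx, hy, ht⟩ := of_eq (by linear_combination h1) h ezx
      refine ⟨2, -p.1 1, ?_, ht⟩
      funext j
      fin_cases j
      exacts [hx, hy, hz]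
  have habc : p.2 0 * p.2 1 * p.2 2 = t ^ 3 := by
    refine mul_left_cancel₀ two ?_
    simp only [hX] at h3
    fin_cases i <;> simp at h3 <;> linear_combination -h3
  have hsum : p.2 0 ^ 2 + p.2 1 ^ 2 + p.2 2 ^ 2 = 3 * t ^ 2 := by
    simp only [hX] at h2
    fin_cases i <;> simp at h2 <;> linear_combination h2
  have ht : t ≠ 0 := by
    rintro rfl
    simp only [zero_mul] at hX
    refine hp6 ⟨by simp [hX], ?_⟩
    grind
  replace hm := hm.resolve_left ht
  rw [hm, mul_assoc] at ea' eb' ec'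
  replace ea' := mul_left_cancel₀ hn ea'
  replace eb' := mul_left_cancel₀ hn eb'
  replace ec' := mul_left_cancel₀ hn ec'
  obtain ⟨s, hs⟩ := exists_cast_unit_mul (a := p.2 0) (c := t)
    (mul_left_cancel₀ ht (by linear_combination p.2 0 * ea' + habc))
  obtain ⟨r, hr⟩ := exists_cast_unit_mul (a := p.2 1) (c := t)
    (mul_left_cancel₀ ht (by linear_combination p.2 1 * eb' + habc))
  have hc : p.2 2 = t * (((s : ℤ) : k) * ((r : ℤ) : k)) :=
    mul_left_cancel₀ ht (by rw [ec', hs, hr]; ring)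
  refine ⟨(i, s, r), t, ht, Prod.ext hX ?_⟩
  funext j
  fin_cases j
  exacts [hs, hr, hc]

/-- over an algebraically closed field of characteristic zero, the point
`[2:-1:-1:1:1:1]` is a singular point of `X`, the singular points of `X` are precisely
the points of its `G`-orbit, and this orbit consists of exactly `12` projective points. -/
theorem stmt_19 (k : Type*) [Field k] [IsAlgClosed k] [CharZero k] :
    IsSingularPt (pt0 (k := k)) ∧
    (∀ p : (Fin 3 → k) × (Fin 3 → k),
      IsSingularPt p ↔ ∃ q ∈ orbitPt0 k, ∃ c : k, c ≠ 0 ∧ p = c • q) ∧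
    ∃ R : Finset ((Fin 3 → k) × (Fin 3 → k)), R.card = 12 ∧ ↑R ⊆ orbitPt0 k ∧
      (∀ q ∈ orbitPt0 k, ∃ r ∈ R, ∃ c : k, c ≠ 0 ∧ q = c • r) ∧
      (∀ r ∈ R, ∀ r' ∈ R, (∃ c : k, c ≠ 0 ∧ r = c • r') → r = r') := by
  have orbit := mem_orbitPt0_iff (k := k)
  have sing (p : (Fin 3 → k) × (Fin 3 → k)) :
      IsSingularPt p ↔ ∃ q ∈ orbitPt0 k, ∃ c : k, c ≠ 0 ∧ p = c • q := by
    constructor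
    · intro hp
      obtain ⟨d, hd⟩ := exists_smul_nodeX_of_isSingularPt hp
      exact ⟨nodeX k d, (orbit _).mpr ⟨d, rfl⟩, hd⟩
    · rintro ⟨q, hq, c, hc, rfl⟩
      obtain ⟨d, rfl⟩ := (orbit q).mp hq
      exact isSingularPt_smul_nodeX d hc
  have inj : Function.Injective (nodeX k) := fun d d' h =>
    nodeX_eq_of_smul (c := (1 : k)) (by rw [one_smul, h])
  refine ⟨(sing _).mpr ⟨pt0, ⟨1, 1, 1, by simp, by simp, by simp [act]⟩, 1, one_ne_zero,
    (one_smul _ _).symm⟩, sing, Finset.univ.map ⟨nodeX k, inj⟩, ?_, ?_, ?_, ?_⟩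
  · simp
  · intro q hq
    obtain ⟨d, -, rfl⟩ := Finset.mem_map.mp hq
    exact (orbit _).mpr ⟨d, rfl⟩
  · intro q hq
    obtain ⟨d, rfl⟩ := (orbit q).mp hq
    exact ⟨nodeX k d, Finset.mem_map_of_mem ⟨nodeX k, inj⟩ (Finset.mem_univ d), 1, one_ne_zero,
      (one_smul _ _).symm⟩
  · intro r hr r' hr' ⟨c, _, h⟩
    obtain ⟨d, -, rfl⟩ := Finset.mem_map.mp hr
    obtain ⟨d', -, rfl⟩ := Finset.mem_map.mp hr'
    exact congrArg (nodeX k) (nodeX_eq_of_smul h)
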